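/- The energy ℓ_node is coercive: ℓ_node(Y) → ∞ as ‖Y‖_F → ∞. Equivalently, for every real number c₀ there exists b > 0 such that ℓ_node(Y) > c₀ for all Y ∈ ℝ^{n×d} with ‖Y‖_F² > b²; in particular every sublevel set {Y : ℓ_node(Y) ≤ c₀} is bounded. -/

import Mathlib

open Matrix

/-- `Softplus(x) = log(1 + eˣ)`. -/
noncomputable def softplus (x : ℝ) : ℝ := Real.log (1 + Real.exp x)

/-- Frobenius norm `‖A‖_F = √(∑ᵢⱼ Aᵢⱼ²)`. -/
noncomputable def frobNorm {n d : ℕ} (A : Matrix (Fin n) (Fin d) ℝ) : ℝ :=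
  Real.sqrt (∑ i, ∑ j, (A i j) ^ 2)

/-- The final node-embedding energy
`ℓ_node(Y) = tr[(Y−F)ᵀ P (Y−F)] + λ·tr(Yᵀ L̃ Y) + (λ_K/K)·Softplus(c − tr(Yᵀ L̃⁻ Y))`. -/
noncomputable def lnode {n d : ℕ} (P Lt Ltneg : Matrix (Fin n) (Fin n) ℝ)
    (F : Matrix (Fin n) (Fin d) ℝ) (lam lamK : ℝ) (K : ℕ) (c : ℝ)
    (Y : Matrix (Fin n) (Fin d) ℝ) : ℝ :=
  ((Y - F)ᵀ * P * (Y - F)).trace + lam * (Yᵀ * Lt * Y).trace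
    + (lamK / K) * softplus (c - (Yᵀ * Ltneg * Y).trace)

theorem softplus_nonneg (x : ℝ) : 0 ≤ softplus x :=
  Real.log_nonneg (by linarith [Real.exp_pos x])

theorem frobNorm_sq {n d : ℕ} (A : Matrix (Fin n) (Fin d) ℝ) :
    frobNorm A ^ 2 = ∑ i, ∑ j, A i j ^ 2 :=
  Real.sq_sqrt (Finset.sum_nonneg fun _ _ => Finset.sum_nonneg fun _ _ => sq_nonneg _)

theorem trace_transpose_mul_mul_nonneg {n d : ℕ} {L : Matrix (Fin n) (Fin n) ℝ}
    (hL : L.PosSemidef) (Y : Matrix (Fin n) (Fin d) ℝ) : 0 ≤ (Yᵀ * L * Y).trace := by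
  simpa using (hL.conjTranspose_mul_mul_same Y).trace_nonneg

theorem trace_transpose_mul_diag_mul {n d : ℕ} {P : Matrix (Fin n) (Fin n) ℝ}
    (hP : P.IsDiag) (A : Matrix (Fin n) (Fin d) ℝ) :
    (Aᵀ * P * A).trace = ∑ i, ∑ j, P i i * A i j ^ 2 := by
  obtain ⟨p, rfl⟩ : ∃ p, P = diagonal p := ⟨P.diag, hP.diagonal_diag.symm⟩
  rw [Finset.sum_comm]
  simp only [trace, diag_apply, mul_apply (M := Aᵀ * diagonal p), mul_diagonal,
    transpose_apply, diagonal_apply_eq]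
  exact Finset.sum_congr rfl fun _ _ => Finset.sum_congr rfl fun _ _ => by ring

theorem exists_pos_forall_le {ι : Type*} [Finite ι] {p : ι → ℝ} (hp : ∀ i, 0 < p i) :
    ∃ m > 0, ∀ i, m ≤ p i := by
  cases isEmpty_or_nonempty ι
  · exact ⟨1, one_pos, isEmptyElim⟩
  · obtain ⟨i, hi⟩ := Finite.exists_min p
    exact ⟨p i, hp i, hi⟩

theorem frobNorm_sq_le_two_mul {n d : ℕ} (Y F : Matrix (Fin n) (Fin d) ℝ) :
    frobNorm Y ^ 2 ≤ 2 * (frobNorm (Y - F) ^ 2 + frobNorm F ^ 2) := by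
  simp only [frobNorm_sq, ← Finset.sum_add_distrib, Finset.mul_sum, Matrix.sub_apply]
  gcongr with i _ j _
  nlinarith [sq_nonneg (Y i j - 2 * F i j)]

theorem mul_frobNorm_sq_le_trace {n d : ℕ} {P : Matrix (Fin n) (Fin n) ℝ} (hP : P.IsDiag)
    {m : ℝ} (hm : ∀ i, m ≤ P i i) (A : Matrix (Fin n) (Fin d) ℝ) :
    m * frobNorm A ^ 2 ≤ (Aᵀ * P * A).trace := by
  rw [trace_transpose_mul_diag_mul hP, frobNorm_sq]
  simp only [Finset.mul_sum]
  gcongr with i _ j _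
  exact hm i

/-- the energy `ℓ_node` is coercive: `ℓ_node(Y) → ∞` as `‖Y‖_F → ∞`.
For every real `c₀` there exists `b > 0` such that `ℓ_node(Y) > c₀` whenever
`‖Y‖_F² > b²`; in particular every sublevel set is bounded. -/
theorem lnode_coercive {n d : ℕ}
    (P Lt Ltneg : Matrix (Fin n) (Fin n) ℝ)
    (hPdiag : P.IsDiag) (hPpos : ∀ i, 0 < P i i)
    (hLt : Lt.PosSemidef) (hLtneg : Ltneg.PosSemidef)
    (F : Matrix (Fin n) (Fin d) ℝ)
    (lam lamK : ℝ) (hlam : 0 < lam) (hlamK : 0 ≤ lamK)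
    (K : ℕ) (hK : 1 ≤ K) (c : ℝ) :
    ∀ c₀ : ℝ, ∃ b > (0 : ℝ), ∀ Y : Matrix (Fin n) (Fin d) ℝ,
      frobNorm Y ^ 2 > b ^ 2 → lnode P Lt Ltneg F lam lamK K c Y > c₀ := by
  intro c₀
  obtain ⟨m, hm, hmP⟩ := exists_pos_forall_le hPpos
  have hS : 0 ≤ 2 * (|c₀| / m + frobNorm F ^ 2) := by positivity
  refine ⟨2 * (|c₀| / m + frobNorm F ^ 2) + 1, by positivity, fun Y hY => ?_⟩
  have hdist : |c₀| / m < frobNorm (Y - F) ^ 2 := by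
    nlinarith [frobNorm_sq_le_two_mul Y F]
  rw [div_lt_iff₀' hm] at hdist
  have hfit := mul_frobNorm_sq_le_trace hPdiag hmP (Y - F)
  have hsmooth := mul_nonneg hlam.le (trace_transpose_mul_mul_nonneg hLt Y)
  have hneg := mul_nonneg (div_nonneg hlamK K.cast_nonneg)
    (softplus_nonneg (c - (Yᵀ * Ltneg * Y).trace))
  unfold lnode
  linarith [le_abs_self c₀]
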